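/- Let K be a field and m ≥ 1 an integer. Then the projective dimension of the edge ring K[G_m] of the two-ear graph G_m as a module over the polynomial ring K[E(G_m)] equals m, and the projective dimension of the edge ring K[P_m] of the one-ear graph P_m as a module over K[E(P_m)] equals m − 1. -/

import Mathlib

open CategoryTheory MvPolynomial Finset
open scoped Classical

noncomputable section

namespace Paper

/-- The monomial `x_u * x_v` associated to an unordered pair `{u, v}` of vertices. -/
def edgeMon (K : Type*) [CommRing K] {V : Type*} (e : Sym2 V) : MvPolynomial V K :=
  Sym2.lift ⟨fun u v => X u * X v, fun u v => mul_comm _ _⟩ e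

/-- The `K`-algebra map `K[E(G)] → K[V(G)]` sending the variable of an edge `{u,v}` to
`x_u * x_v`. -/
def edgeHom (K : Type*) [CommRing K] {V : Type*} (G : SimpleGraph V) :
    MvPolynomial G.edgeSet K →ₐ[K] MvPolynomial V K :=
  aeval (fun e => edgeMon K (e : Sym2 V))

/-- The toric ideal of a simple graph. -/
def toricIdeal (K : Type*) [CommRing K] {V : Type*} (G : SimpleGraph V) :
    Ideal (MvPolynomial G.edgeSet K) :=
  RingHom.ker (edgeHom K G).toRingHom

/-- The edge ring `K[G] = K[E(G)]/I_G`. -/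
abbrev edgeRing (K : Type*) [CommRing K] {V : Type*} (G : SimpleGraph V) :=
  MvPolynomial G.edgeSet K ⧸ toricIdeal K G

open CategoryTheory.Limits in
/-- The projective dimension of a module, as an element of `ℕ∞`:  the least `n` such that `M`
admits a projective resolution vanishing in homological degrees `> n` (or `⊤` if there is
no such finite resolution). -/
def projDim (R : Type*) [CommRing R] (M : ModuleCat R) : ℕ∞ :=
  sInf {n : ℕ∞ | ∃ m : ℕ, (m : ℕ∞) = n ∧
    ∃ P : ProjectiveResolution M, ∀ i : ℕ, m < i → IsZero (P.complex.X i)}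

/-- The 0-1 vector `ε_u + ε_v` attached to an unordered pair `{u,v}` with `u ≠ v`. -/
def edgeVec {V : Type*} (e : Sym2 V) : V → ℝ :=
  fun v => if v ∈ e then 1 else 0

/-- The edge cone of a finite simple graph: all nonnegative real combinations of the vectors
`v_e = ε_u + ε_v`, for `e = {u,v}` an edge of `G`. -/
def edgeCone {V : Type*} [Fintype V] (G : SimpleGraph V) : Set (V → ℝ) :=
  {x | ∃ a : Sym2 V → ℝ, (∀ e, 0 ≤ a e) ∧ (∀ e, e ∉ G.edgeSet → a e = 0) ∧
    x = ∑ e : Sym2 V, a e • edgeVec e}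

/-- A vector has integer coordinates. -/
def IsIntegralVec {V : Type*} (x : V → ℝ) : Prop := ∀ v, ∃ n : ℤ, x v = n

/-- A minimal vector of `relint(ℝ₊(G)) ∩ ℤ^{V(G)}`. -/
def IsMinimalVec {V : Type*} [Fintype V] (G : SimpleGraph V) (x : V → ℝ) : Prop :=
  x ∈ intrinsicInterior ℝ (edgeCone G) ∧ IsIntegralVec x ∧
    ¬ ∃ y z : V → ℝ, (y ∈ intrinsicInterior ℝ (edgeCone G) ∧ IsIntegralVec y) ∧
      (z ∈ edgeCone G ∧ IsIntegralVec z ∧ z ≠ 0) ∧ x = y + z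

/-! ### Multi-path graphs.  `c i` is the number of interior vertices of the `i`-th path,
so the `i`-th path has length `c i + 1`. -/

/-- Vertices of the multi-path graph: `Sum.inl 0 = v1`, `Sum.inl 1 = v2`, and
`Sum.inr ⟨i, j⟩ = u_{i,j+1}`, the `(j+1)`-st interior vertex of the `i`-th path. -/
abbrev MPV {m : ℕ} (c : Fin m → ℕ) : Type := Fin 2 ⊕ (Σ i : Fin m, Fin (c i))

def mpRel {m : ℕ} (c : Fin m → ℕ) : MPV c → MPV c → Prop
  | Sum.inl a, Sum.inr ⟨i, j⟩ => (a = 0 ∧ (j : ℕ) = 0) ∨ (a = 1 ∧ (j : ℕ) + 1 = c i)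
  | Sum.inr ⟨i, j⟩, Sum.inr ⟨i', j'⟩ => (i : ℕ) = i' ∧ (j' : ℕ) = (j : ℕ) + 1
  | _, _ => False

/-- The multi-path graph with `m` paths, the `i`-th of which has `c i` interior vertices
(hence length `c i + 1`), all starting at `v1 = Sum.inl 0` and ending at `v2 = Sum.inl 1`. -/
def multiPath {m : ℕ} (c : Fin m → ℕ) : SimpleGraph (MPV c) :=
  SimpleGraph.fromRel (mpRel c)

/-! ### The two-ear graph `G_m` and the one-ear graph `P_m`. -/

/-- Vertices of the two-ear graph:  `Sum.inl 0 = v1`, `Sum.inl 1 = v2`, `Sum.inl 2 = x1`,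
`Sum.inl 3 = x2`, `Sum.inl 4 = y1`, `Sum.inl 5 = y2`, and `Sum.inr i = u_{i+1}`. -/
abbrev TEV (m : ℕ) : Type := Fin 6 ⊕ Fin (m - 1)

def teRel (m : ℕ) : TEV m → TEV m → Prop
  | Sum.inl a, Sum.inl b =>
      (a = 0 ∧ b = 2) ∨ (a = 0 ∧ b = 3) ∨ (a = 2 ∧ b = 3) ∨ (a = 1 ∧ b = 4) ∨
      (a = 1 ∧ b = 5) ∨ (a = 4 ∧ b = 5) ∨ (a = 2 ∧ b = 4)
  | Sum.inl a, Sum.inr _ => a = 0 ∨ a = 1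
  | _, _ => False

/-- The two-ear graph `𝐆_m`. -/
def twoEar (m : ℕ) : SimpleGraph (TEV m) := SimpleGraph.fromRel (teRel m)

/-- The one-ear graph `𝐏_m`, the induced subgraph of `𝐆_m` on the complement of `x2`. -/
def oneEar (m : ℕ) : SimpleGraph ({v : TEV m | v ≠ Sum.inl 3} : Set (TEV m)) :=
  (twoEar m).induce {v : TEV m | v ≠ Sum.inl 3}

/-! ### Cycles, the odd-cycle condition, and compact graphs. -/

/-- The odd-cycle condition: any two vertex-disjoint odd cycles are joined by an edge. -/
def OddCycleCondition {V : Type*} (G : SimpleGraph V) : Prop :=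
  ∀ (a b : V) (c₁ : G.Walk a a) (c₂ : G.Walk b b), c₁.IsCycle → c₂.IsCycle →
    Odd c₁.length → Odd c₂.length →
    (∀ x, x ∈ c₁.support → x ∉ c₂.support) →
    ∃ x ∈ c₁.support, ∃ y ∈ c₂.support, G.Adj x y

/-- `G` has no even cycle. -/
def HasNoEvenCycle {V : Type*} (G : SimpleGraph V) : Prop :=
  ∀ (a : V) (c : G.Walk a a), c.IsCycle → ¬ Even c.length

/-- A compact graph: connected, all degrees at least `2`, no even cycle, and the
odd-cycle condition holds. -/
def IsCompactGraph {V : Type*} (G : SimpleGraph V) : Prop :=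
  G.Connected ∧ (∀ v : V, 2 ≤ (G.neighborSet v).ncard) ∧ HasNoEvenCycle G ∧ OddCycleCondition G

/-- The number `t(G)` of minimal (= induced) cycles of `G`, counted via their vertex sets. -/
def cycleCount {V : Type*} (G : SimpleGraph V) : ℕ :=
  Set.ncard {S : Set V | ∃ (a : V) (c : G.Walk a a), c.IsCycle ∧
    (∀ x y, x ∈ c.support → y ∈ c.support → G.Adj x y → s(x, y) ∈ c.edges) ∧
    S = {x | x ∈ c.support}}


section Bridge
universe v u
variable {C : Type u} [Category.{v} C] [Abelian C]

open CategoryTheory.Limits in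
/-- A projective resolution of the kernel extends to a projective resolution. -/
lemma exists_resolution_splice {S : ShortComplex C} (hS : S.ShortExact) [Projective S.X₂]
    (Q : ProjectiveResolution S.X₁) (n : ℕ) (hQ : ∀ i, n < i → IsZero (Q.complex.X i)) :
    ∃ P : ProjectiveResolution S.X₃, ∀ i, n + 1 < i → IsZero (P.complex.X i) := by
  have hepi : Epi S.g := hS.epi_g
  have hmono : Mono S.f := hS.mono_f
  let f₀ : Q.complex.X 0 ⟶ S.X₁ := Q.π.f 0
  have hf₀ : Q.complex.d 1 0 ≫ f₀ = 0 := Q.complex_d_comp_π_f_zero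
  have hex0 : (ShortComplex.mk _ _ hf₀).Exact := Q.exact₀
  have hepi0 : Epi f₀ := inferInstanceAs (Epi (Q.π.f 0))
  have hw : Q.complex.d 1 0 ≫ (f₀ ≫ S.f) = 0 := by rw [← Category.assoc, hf₀, zero_comp]
  let D : ChainComplex C ℕ := ChainComplex.augment Q.complex (f₀ ≫ S.f) hw
  have hproj : ∀ n, Projective (D.X n) := by
    intro k
    cases k with
    | zero => exact inferInstanceAs (Projective S.X₂)
    | succ k => exact Q.projective k
  have hD10 : D.d 1 0 = f₀ ≫ S.f := rfl
  have hexact : ∀ k, D.ExactAt (k + 1) := by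
    intro k
    rw [HomologicalComplex.exactAt_iff' _ (k + 1 + 1) (k + 1) k (by simp) (by simp)]
    cases k with
    | zero =>
      have : (ShortComplex.mk _ _ hw).Exact := by
        let φ : ShortComplex.mk _ _ hf₀ ⟶ ShortComplex.mk _ _ hw :=
          { τ₁ := 𝟙 _, τ₂ := 𝟙 _, τ₃ := S.f }
        have : Epi φ.τ₁ := inferInstanceAs (Epi (𝟙 _))
        have : IsIso φ.τ₂ := inferInstanceAs (IsIso (𝟙 _))
        have : Mono φ.τ₃ := hmono
        exact (ShortComplex.exact_iff_of_epi_of_isIso_of_mono φ).1 hex0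
      exact this
    | succ k =>
      exact Q.exact_succ k
  have hcomp : D.d 1 0 ≫ S.g = 0 := by
    have h : (f₀ ≫ S.f) ≫ S.g = 0 := by rw [Category.assoc, S.zero, comp_zero]
    exact h
  have hex1 : (ShortComplex.mk _ _ hcomp).Exact := by
    let φ : ShortComplex.mk (D.d 1 0) S.g hcomp ⟶ S :=
      { τ₁ := f₀, τ₂ := 𝟙 _, τ₃ := 𝟙 _ , comm₁₂ := by
          change f₀ ≫ S.f = (f₀ ≫ S.f) ≫ 𝟙 _
          rw [Category.comp_id]
        comm₂₃ := by
          change 𝟙 _ ≫ S.g = S.g ≫ 𝟙 _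
          simp }
    have : Epi φ.τ₁ := hepi0
    have : IsIso φ.τ₂ := inferInstanceAs (IsIso (𝟙 _))
    have : Mono φ.τ₃ := inferInstanceAs (Mono (𝟙 _))
    exact (ShortComplex.exact_iff_of_epi_of_isIso_of_mono φ).2 hS.exact
  have hπ : ((ChainComplex.toSingle₀Equiv D S.X₃).symm ⟨S.g, hcomp⟩).f 0 = S.g :=
    ChainComplex.toSingle₀Equiv_symm_apply_f_zero (C := D) S.g hcomp
  refine ⟨{ complex := D
            projective := hproj
            π := (ChainComplex.toSingle₀Equiv _ _).symm ⟨S.g, hcomp⟩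
            quasiIso := ⟨fun n => ?_⟩ }, ?_⟩
  · cases n
    · rw [ChainComplex.quasiIsoAt₀_iff, ShortComplex.quasiIso_iff_of_zeros']
      · refine (ShortComplex.exact_and_epi_g_iff_of_iso ?_).2 ⟨hex1, hepi⟩
        exact ShortComplex.isoMk (Iso.refl _) (Iso.refl _) (Iso.refl _)
          ((Category.id_comp _).trans (Category.comp_id _).symm)
          ((Category.id_comp _).trans ((Category.comp_id _).trans hπ).symm)
      all_goals rfl
    · rw [quasiIsoAt_iff_exactAt']
      · apply hexact
      · apply ChainComplex.exactAt_succ_single_obj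
  · intro i hi
    cases i with
    | zero => omega
    | succ i => exact hQ i (by omega)

open CategoryTheory.Limits in
lemma exists_resolution_of_LE [EnoughProjectives C] (n : ℕ) (M : C)
    (h : HasProjectiveDimensionLE M n) :
    ∃ P : ProjectiveResolution M, ∀ i, n < i → IsZero (P.complex.X i) := by
  induction n generalizing M with
  | zero =>
    have : Projective M := (projective_iff_hasProjectiveDimensionLE_zero M).2 h
    refine ⟨ProjectiveResolution.self M, fun i hi => ?_⟩
    exact HomologicalComplex.isZero_single_obj_X _ _ _ _ (by omega)
  | succ n ih =>
    obtain ⟨⟨P, f⟩⟩ := EnoughProjectives.presentation M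
    let T := ShortComplex.mk (kernel.ι f) f (kernel.condition f)
    have hT : T.ShortExact := { exact := ShortComplex.exact_kernel f }
    have hP : Projective T.X₂ := ‹Projective P›
    have h1 : HasProjectiveDimensionLE T.X₁ n :=
      (hT.hasProjectiveDimensionLT_X₃_iff n hP).mp h
    obtain ⟨Q, hQ⟩ := ih T.X₁ h1
    exact exists_resolution_splice hT Q n hQ

open CategoryTheory.Limits in
lemma LE_of_resolution (n : ℕ) (M : C) (P : ProjectiveResolution M)
    (h : ∀ i, n < i → IsZero (P.complex.X i)) : HasProjectiveDimensionLE M n := by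
  let := HasExt.standard C
  rw [HasProjectiveDimensionLE, hasProjectiveDimensionLT_iff]
  intro i hi Y e
  obtain ⟨f, hf, rfl⟩ := P.extMk_surjective e (i + 1) rfl
  have : f = 0 := (h i (by omega)).eq_of_src _ _
  subst this
  exact P.extMk_zero _ _

lemma projDim_eq {R : Type u} [CommRing R] (M : ModuleCat.{u} R) (n : ℕ)
    (h1 : HasProjectiveDimensionLE M n) (h2 : ¬ HasProjectiveDimensionLT M n) :
    projDim R M = n := by
  apply le_antisymm
  · exact sInf_le ⟨n, rfl, exists_resolution_of_LE n M h1⟩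
  · refine le_sInf ?_
    rintro _ ⟨k, rfl, P, hP⟩
    by_contra hlt
    have hlt : k < n := by simpa using hlt
    have := LE_of_resolution k M P hP
    exact h2 (hasProjectiveDimensionLT_of_ge M (k + 1) n hlt)
end Bridge

section Determinantal
universe u
variable {S : Type u} [CommRing S]

/-- Abbreviation for the projective dimension bound of an unbundled module. -/
def PdLT (S : Type u) [CommRing S] (M : Type u) [AddCommGroup M] [Module S M] (n : ℕ) : Prop :=
  HasProjectiveDimensionLT (ModuleCat.of S M) n

lemma PdLT.mono {M : Type u} [AddCommGroup M] [Module S M] {n k : ℕ} (h : PdLT S M n)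
    (hk : n ≤ k) : PdLT S M k :=
  let _ : HasProjectiveDimensionLT (ModuleCat.of S M) n := h
  hasProjectiveDimensionLT_of_ge _ n k hk

lemma PdLT.equiv {M N : Type u} [AddCommGroup M] [Module S M] [AddCommGroup N] [Module S N]
    {n : ℕ} (h : PdLT S M n) (e : M ≃ₗ[S] N) : PdLT S N n :=
  let _ : HasProjectiveDimensionLT (ModuleCat.of S M) n := h
  hasProjectiveDimensionLT_of_iso e.toModuleIso n

section ses
variable {M N P : Type u} [AddCommGroup M] [Module S M] [AddCommGroup N] [Module S N]
  [AddCommGroup P] [Module S P] (f : M →ₗ[S] N) (g : N →ₗ[S] P)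

lemma ses_shortExact (hf : Function.Injective f) (hfg : Function.Exact f g)
    (hg : Function.Surjective g) :
    (ShortComplex.mk (ModuleCat.ofHom f) (ModuleCat.ofHom g)
      (by ext x; exact hfg.apply_apply_eq_zero x)).ShortExact where
  exact := (ShortComplex.ShortExact.moduleCat_exact_iff_function_exact _).2 hfg
  mono_f := (ModuleCat.mono_iff_injective _).2 hf
  epi_g := (ModuleCat.epi_iff_surjective _).2 hg

lemma PdLT.third (hf : Function.Injective f) (hfg : Function.Exact f g)
    (hg : Function.Surjective g) {n : ℕ} (h₁ : PdLT S M n) (h₂ : PdLT S N (n + 1)) :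
    PdLT S P (n + 1) :=
  (ses_shortExact f g hf hfg hg).hasProjectiveDimensionLT_X₃ n h₁ h₂

lemma PdLT.first (hf : Function.Injective f) (hfg : Function.Exact f g)
    (hg : Function.Surjective g) {n : ℕ} (h₂ : PdLT S N n) (h₃ : PdLT S P (n + 1)) :
    PdLT S M n :=
  (ses_shortExact f g hf hfg hg).hasProjectiveDimensionLT_X₁ n h₂ h₃
end ses


lemma pdLT_self : PdLT S S 1 := by
  have : Projective (ModuleCat.of S S) := ModuleCat.projective_of_free (Module.Basis.singleton Unit S)
  exact inferInstanceAs (HasProjectiveDimensionLT (ModuleCat.of S S) 1)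

/-- The kernel of `S/A → S/B` is `B/A`. -/
lemma exact_factor {A B : Ideal S} (h : A ≤ B) :
    Function.Exact (Submodule.map A.mkQ B).subtype (Submodule.factor h) := by
  rw [LinearMap.exact_iff, Submodule.range_subtype, Submodule.factor, Submodule.ker_mapQ,
    Submodule.comap_id]

lemma pdLT_quotient_sup_span {A : Ideal S} {x : S} (hx : ∀ y, x * y ∈ A → y ∈ A) {n : ℕ}
    (h : PdLT S (S ⧸ A) n) : PdLT S (S ⧸ (A ⊔ Ideal.span {x})) (n + 1) := by
  refine PdLT.third (LinearMap.lsmul S (S ⧸ A) x) (Submodule.factor le_sup_left) ?_ ?_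
    (Submodule.factor_surjective _) h (h.mono (Nat.le_succ n))
  · rw [← LinearMap.ker_eq_bot, LinearMap.ker_eq_bot']
    intro y hy
    obtain ⟨y, rfl⟩ := Submodule.mkQ_surjective _ y
    rw [LinearMap.lsmul_apply, ← map_smul, Submodule.mkQ_apply, Submodule.Quotient.mk_eq_zero,
      smul_eq_mul] at hy
    rw [Submodule.mkQ_apply, Submodule.Quotient.mk_eq_zero]
    exact hx y hy
  · intro y
    obtain ⟨y, rfl⟩ := Submodule.mkQ_surjective _ y
    rw [Submodule.factor_mk, Submodule.mkQ_apply, Submodule.Quotient.mk_eq_zero]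
    constructor
    · intro hy
      obtain ⟨a, ha, b, hb, rfl⟩ := Submodule.mem_sup.1 hy
      obtain ⟨t, rfl⟩ := Ideal.mem_span_singleton'.1 hb
      refine ⟨A.mkQ t, ?_⟩
      rw [LinearMap.lsmul_apply, ← map_smul, Submodule.mkQ_apply, Submodule.mkQ_apply,
        Submodule.Quotient.eq, smul_eq_mul]
      have : x * t - (a + t * x) = -a := by ring
      rw [this]
      exact A.neg_mem ha
    · rintro ⟨z, hz⟩
      obtain ⟨z, rfl⟩ := Submodule.mkQ_surjective _ z
      rw [LinearMap.lsmul_apply, ← map_smul, Submodule.mkQ_apply, Submodule.mkQ_apply,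
        Submodule.Quotient.eq, smul_eq_mul] at hz
      have : y = -(x * z - y) + z * x := by ring
      rw [this]
      exact Submodule.add_mem_sup (A.neg_mem hz) (Ideal.mul_mem_left _ _ (Ideal.mem_span_singleton_self x))

/-- The `2 × 2` minor of the columns `i`, `j`. -/
def dt (c d : ℕ → S) (i j : ℕ) : S := c i * d j - c j * d i

/-- The ideal of `2 × 2` minors of the first `k` columns. -/
def minorIdeal (c d : ℕ → S) (k : ℕ) : Ideal S :=
  Ideal.span {x | ∃ i j, i < k ∧ j < k ∧ x = dt c d i j}

/-- The ideal generated by the first `k` entries of the first row. -/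
def rowIdeal (c : ℕ → S) (k : ℕ) : Ideal S := Ideal.span (c '' {i | i < k})

lemma dt_mem (c d : ℕ → S) {i j k : ℕ} (hi : i < k) (hj : j < k) :
    dt c d i j ∈ minorIdeal c d k := Ideal.subset_span ⟨i, j, hi, hj, rfl⟩

lemma minorIdeal_mono (c d : ℕ → S) {k l : ℕ} (h : k ≤ l) :
    minorIdeal c d k ≤ minorIdeal c d l := by
  refine Ideal.span_mono ?_
  rintro x ⟨i, j, hi, hj, rfl⟩
  exact ⟨i, j, by omega, by omega, rfl⟩

lemma minorIdeal_one (c d : ℕ → S) : minorIdeal c d 1 = ⊥ := by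
  rw [eq_bot_iff, minorIdeal, Ideal.span_le]
  rintro x ⟨i, j, hi, hj, rfl⟩
  obtain rfl : i = 0 := by omega
  obtain rfl : j = 0 := by omega
  simp [dt]

lemma minorIdeal_le_rowIdeal (c d : ℕ → S) (k : ℕ) : minorIdeal c d k ≤ rowIdeal c k := by
  rw [minorIdeal, Ideal.span_le]
  rintro x ⟨i, j, hi, hj, rfl⟩
  exact Ideal.sub_mem _ (Ideal.mul_mem_right _ _ (Ideal.subset_span ⟨i, hi, rfl⟩))
    (Ideal.mul_mem_right _ _ (Ideal.subset_span ⟨j, hj, rfl⟩))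

lemma pdLT_rowIdeal (c : ℕ → S) (N : ℕ)
    (hreg : ∀ k < N, ∀ y, c k * y ∈ rowIdeal c k → y ∈ rowIdeal c k) (k : ℕ) (hk : k ≤ N) :
    PdLT S (S ⧸ rowIdeal c k) (k + 1) := by
  induction k with
  | zero =>
    have : rowIdeal c 0 = ⊥ := by simp [rowIdeal]
    rw [this]
    exact pdLT_self.equiv (Submodule.quotEquivOfEqBot ⊥ rfl).symm
  | succ k ih =>
    have : rowIdeal c (k + 1) = rowIdeal c k ⊔ Ideal.span {c k} := by
      have h1 : {i | i < k + 1} = {i | i < k} ∪ {k} := by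
        ext i; simp; omega
      rw [rowIdeal, h1, Set.image_union, Ideal.span_union, Set.image_singleton, rowIdeal]
    rw [this]
    exact pdLT_quotient_sup_span (hreg k (by omega)) (ih (by omega))

/-- Multiplication by `c 0` resp. `dt 0 k` identifies the two submodules of `S / J_k`. -/
lemma map_smul_minor_eq (c d : ℕ → S) (k : ℕ) (hk : 1 ≤ k) :
    Submodule.map (LinearMap.lsmul S (S ⧸ minorIdeal c d k) (c 0))
      (Submodule.map (minorIdeal c d k).mkQ (minorIdeal c d (k + 1))) =
    Submodule.map (LinearMap.lsmul S (S ⧸ minorIdeal c d k) (dt c d 0 k))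
      (Submodule.map (minorIdeal c d k).mkQ (rowIdeal c k)) := by
  have key : ∀ i < k, (minorIdeal c d k).mkQ (c 0 * dt c d i k) =
      (minorIdeal c d k).mkQ (dt c d 0 k * c i) := by
    intro i hi
    rw [Submodule.mkQ_apply, Submodule.mkQ_apply, Submodule.Quotient.eq]
    have : c 0 * dt c d i k - dt c d 0 k * c i = - c k * dt c d 0 i := by
      simp only [dt]; ring
    rw [this]
    exact Ideal.mul_mem_left _ _ (dt_mem c d (by omega) hi)
  apply le_antisymm
  · rw [Submodule.map_le_iff_le_comap, Submodule.map_le_iff_le_comap]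
    conv_lhs => rw [minorIdeal]
    rw [Ideal.span, Submodule.span_le]
    rintro x ⟨i, j, hi, hj, rfl⟩
    have claim : ∀ i < k, dt c d 0 k • (minorIdeal c d k).mkQ (c i) ∈
        Submodule.map (LinearMap.lsmul S (S ⧸ minorIdeal c d k) (dt c d 0 k))
          (Submodule.map (minorIdeal c d k).mkQ (rowIdeal c k)) := fun i hi =>
      ⟨_, ⟨c i, Ideal.subset_span ⟨i, hi, rfl⟩, rfl⟩, rfl⟩
    simp only [SetLike.mem_coe, Submodule.mem_comap, LinearMap.lsmul_apply]
    by_cases hi' : i < k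
    · by_cases hj' : j < k
      · have : (minorIdeal c d k).mkQ (dt c d i j) = 0 := by
          rw [Submodule.mkQ_apply, Submodule.Quotient.mk_eq_zero]
          exact dt_mem c d hi' hj'
        rw [this, smul_zero]
        exact Submodule.zero_mem _
      · obtain rfl : j = k := by omega
        rw [← map_smul, smul_eq_mul, key i hi', ← smul_eq_mul, map_smul]
        exact claim i hi'
    · obtain rfl : i = k := by omega
      by_cases hj' : j < i
      · have : dt c d i j = - dt c d j i := by simp only [dt]; ring
        rw [this, map_neg, smul_neg, ← map_smul, smul_eq_mul, key j hj', ← smul_eq_mul, map_smul]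
        exact Submodule.neg_mem _ (claim j hj')
      · obtain rfl : j = i := by omega
        have : dt c d j j = 0 := by simp only [dt]; ring
        rw [this, map_zero, smul_zero]
        exact Submodule.zero_mem _
  · rw [Submodule.map_le_iff_le_comap, Submodule.map_le_iff_le_comap, rowIdeal, Ideal.span,
      Submodule.span_le]
    rintro _ ⟨i, hi, rfl⟩
    simp only [SetLike.mem_coe, Submodule.mem_comap, LinearMap.lsmul_apply]
    rw [← map_smul, smul_eq_mul, ← key i hi, ← smul_eq_mul, map_smul]
    exact ⟨_, ⟨dt c d i k, dt_mem c d (Nat.lt_succ_of_lt hi) (Nat.lt_succ_self k), rfl⟩, rfl⟩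

lemma lsmul_injective_of_prime {P : Ideal S} (hP : P.IsPrime) {x : S} (hx : x ∉ P) :
    Function.Injective (LinearMap.lsmul S (S ⧸ P) x) := by
  rw [← LinearMap.ker_eq_bot, LinearMap.ker_eq_bot']
  intro y hy
  obtain ⟨y, rfl⟩ := Submodule.mkQ_surjective _ y
  rw [LinearMap.lsmul_apply, ← map_smul, Submodule.mkQ_apply, Submodule.Quotient.mk_eq_zero,
    smul_eq_mul] at hy
  rw [Submodule.mkQ_apply, Submodule.Quotient.mk_eq_zero]
  exact (hP.mem_or_mem hy).resolve_left hx

lemma pdLT_minorIdeal (c d : ℕ → S) (N : ℕ)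
    (hprime : ∀ k, 1 ≤ k → k ≤ N → (minorIdeal c d k).IsPrime)
    (hc : ∀ k, 1 ≤ k → k ≤ N → c 0 ∉ minorIdeal c d k)
    (hd : ∀ k, 1 ≤ k → k ≤ N → dt c d 0 k ∉ minorIdeal c d k)
    (hreg : ∀ k < N, ∀ y, c k * y ∈ rowIdeal c k → y ∈ rowIdeal c k) (k : ℕ) (hk : k ≤ N) :
    PdLT S (S ⧸ minorIdeal c d (k + 1)) (k + 1) := by
  induction k with
  | zero =>
    rw [zero_add, minorIdeal_one]
    exact pdLT_self.equiv (Submodule.quotEquivOfEqBot ⊥ rfl).symm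
  | succ k ih =>
    specialize ih (by omega)
    have hp := hprime (k + 1) (by omega) hk
    have h1 : PdLT S (Submodule.map (minorIdeal c d (k + 1)).mkQ (rowIdeal c (k + 1))) (k + 1) :=
      PdLT.first _ _ (Submodule.injective_subtype _)
        (exact_factor (minorIdeal_le_rowIdeal c d (k + 1))) (Submodule.factor_surjective _) ih
        (pdLT_rowIdeal c N hreg (k + 1) hk)
    have e1 := Submodule.equivMapOfInjective _
      (lsmul_injective_of_prime hp (hd (k + 1) (by omega) hk))
      (Submodule.map (minorIdeal c d (k + 1)).mkQ (rowIdeal c (k + 1)))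
    have e2 := Submodule.equivMapOfInjective _
      (lsmul_injective_of_prime hp (hc (k + 1) (by omega) hk))
      (Submodule.map (minorIdeal c d (k + 1)).mkQ (minorIdeal c d (k + 1 + 1)))
    have e3 := LinearEquiv.ofEq _ _ (map_smul_minor_eq c d (k + 1) (by omega))
    have h2 := ((h1.equiv e1).equiv e3.symm).equiv e2.symm
    exact PdLT.third _ _ (Submodule.injective_subtype _)
        (exact_factor (minorIdeal_mono c d (Nat.le_succ (k + 1)))) (Submodule.factor_surjective _)
        h2 (ih.mono (Nat.le_succ _))

end Determinantal

section Lower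
universe u
variable {S : Type u} [CommRing S]

/-- The sequence of minors involving the column `0`, in the localization. -/
def minorSeq (A : Type u) [CommRing A] [Algebra S A] (c d : ℕ → S) (n : ℕ) : List A :=
  (List.range n).map (fun k => algebraMap S A (dt c d 0 (k + 1)))

lemma ofList_minorSeq (A : Type u) [CommRing A] [Algebra S A] (c d : ℕ → S) (n : ℕ)
    (hu : IsUnit (algebraMap S A (c 0))) :
    Ideal.ofList (minorSeq A c d n) = (minorIdeal c d (n + 1)).map (algebraMap S A) := by
  apply le_antisymm
  · rw [Ideal.ofList, Ideal.span_le]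
    intro x hx
    obtain ⟨k, hk, rfl⟩ := List.mem_map.1 hx
    exact Ideal.mem_map_of_mem _ (dt_mem c d (by omega) (by simpa using hk))
  · rw [Ideal.map_le_iff_le_comap, minorIdeal, Ideal.span_le]
    have h0 : ∀ j < n + 1, algebraMap S A (dt c d 0 j) ∈ Ideal.ofList (minorSeq A c d n) := by
      intro j hj
      cases j with
      | zero =>
        have : dt c d 0 0 = 0 := by simp only [dt]; ring
        rw [this, map_zero]
        exact Ideal.zero_mem _
      | succ j =>
        exact Ideal.subset_span (List.mem_map.2 ⟨j, by simpa using hj, rfl⟩)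
    rintro x ⟨i, j, hi, hj, rfl⟩
    rw [SetLike.mem_coe, Ideal.mem_comap, ← Ideal.unit_mul_mem_iff_mem _ hu, ← map_mul]
    have : c 0 * dt c d i j = c i * dt c d 0 j - c j * dt c d 0 i := by
      simp only [dt]; ring
    rw [this, map_sub, map_mul, map_mul]
    exact Ideal.sub_mem _ (Ideal.mul_mem_left _ _ (h0 j hj)) (Ideal.mul_mem_left _ _ (h0 i hi))

/-- The localized module agrees with any other localization. -/
def localizedEquiv (M : ModuleCat.{u} S) (T : Submonoid S) {M' : Type u} [AddCommGroup M']
    [Module S M'] [Module (Localization T) M'] [IsScalarTower S (Localization T) M']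
    (f : M →ₗ[S] M') (hf : IsLocalizedModule T f) :
    M.localizedModule T ≃ₗ[Localization T] M' :=
  LinearEquiv.extendScalarsOfIsLocalization T (Localization T)
      (IsLocalizedModule.linearEquiv T (M.localizedModuleMkLinearMap T) f)

lemma not_pdLT_minorIdeal [IsNoetherianRing S] (c d : ℕ → S) (N : ℕ)
    (hprime : ∀ k, 1 ≤ k → k ≤ N + 1 → (minorIdeal c d k).IsPrime)
    (hc : c 0 ∉ minorIdeal c d (N + 1))
    (hd : ∀ k, 1 ≤ k → k ≤ N → dt c d 0 k ∉ minorIdeal c d k) :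
    ¬ PdLT S (S ⧸ minorIdeal c d (N + 1)) N := by
  set P := minorIdeal c d (N + 1) with hPdef
  have hP : P.IsPrime := hprime (N + 1) (by omega) le_rfl
  let A := Localization P.primeCompl
  have : IsLocalRing A := inferInstanceAs (IsLocalRing (Localization.AtPrime P))
  have : IsNoetherianRing A := inferInstanceAs (IsNoetherianRing (Localization P.primeCompl))
  have hu : IsUnit (algebraMap S A (c 0)) :=
    IsLocalization.map_units A (⟨c 0, hc⟩ : P.primeCompl)
  have hdisj : ∀ k ≤ N, Disjoint (P.primeCompl : Set S) (minorIdeal c d (k + 1) : Set S) := by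
    intro k hk
    rw [Set.disjoint_left]
    intro x hx hx'
    exact hx (minorIdeal_mono c d (by omega) hx')
  have hlen : (minorSeq A c d N).length = N := by simp [minorSeq]
  have hreg : RingTheory.Sequence.IsWeaklyRegular A (minorSeq A c d N) := by
    constructor
    intro i hi
    have hi' : i < N := by rwa [hlen] at hi
    have htake : (minorSeq A c d N).take i = minorSeq A c d i := by
      rw [minorSeq, ← List.map_take, List.take_range, minorSeq, min_eq_left hi'.le]
    have hget : (minorSeq A c d N)[i] = algebraMap S A (dt c d 0 (i + 1)) := by
      simp [minorSeq]
    rw [hget, htake, smul_eq_mul, Ideal.mul_top, ofList_minorSeq A c d i hu]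
    have hp' := IsLocalization.isPrime_of_isPrime_disjoint P.primeCompl A _
      (hprime (i + 1) (by omega) (by omega)) (hdisj i hi'.le)
    refine lsmul_injective_of_prime hp' ?_
    intro hmem
    have h5 : dt c d 0 (i + 1) ∈
        ((minorIdeal c d (i + 1)).map (algebraMap S A)).under S := Ideal.mem_comap.2 hmem
    rw [IsLocalization.under_map_of_isPrime_disjoint P.primeCompl A
      (hprime (i + 1) (by omega) (by omega)) (hdisj i hi'.le)] at h5
    exact hd (i + 1) (by omega) (by omega) h5
  have hmem : ∀ r ∈ minorSeq A c d N, r ∈ IsLocalRing.maximalIdeal A := by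
    intro r hr
    have h1 : r ∈ P.map (algebraMap S A) := by
      rw [← ofList_minorSeq A c d N hu]
      exact Ideal.subset_span hr
    have hp' := IsLocalization.isPrime_of_isPrime_disjoint P.primeCompl A _ hP (hdisj N le_rfl)
    exact IsLocalRing.le_maximalIdeal hp'.ne_top h1
  have hpd := ModuleCat.projectiveDimension_quotient_eq_add_length_of_isWeaklyRegular
    (ModuleCat.of A A) (minorSeq A c d N) hreg hmem
  have hA : Projective (ModuleCat.of A A) :=
    ModuleCat.projective_of_free (Module.Basis.singleton Unit A)
  have hnt : Nontrivial (ModuleCat.of A A) := inferInstanceAs (Nontrivial A)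
  rw [ModuleCat.projectiveDimension_eq_zero_of_projective (ModuleCat.of A A), zero_add, hlen] at hpd
  intro hlt
  have h1 : projectiveDimension (ModuleCat.of S (S ⧸ P)) < N := projectiveDimension_lt_iff.2 hlt
  have h2 := ModuleCat.projectiveDimension_le_projectiveDimension_of_isLocalizedModule
    P.primeCompl (ModuleCat.of S (S ⧸ P))
  let e : (ModuleCat.of S (S ⧸ P)).localizedModule P.primeCompl ≃ₗ[A]
      (A ⧸ (Submodule.localized' A P.primeCompl (Algebra.linearMap S A) P)) :=
    localizedEquiv (ModuleCat.of S (S ⧸ P)) P.primeCompl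
        (Submodule.toLocalizedQuotient' A P.primeCompl (Algebra.linearMap S A) P)
        inferInstance
  have heq : (Submodule.localized' A P.primeCompl (Algebra.linearMap S A) P) =
      Ideal.ofList (minorSeq A c d N) • (⊤ : Submodule A A) := by
    rw [Ideal.localized'_eq_map, ofList_minorSeq A c d N hu, smul_eq_mul, Ideal.mul_top]
  let e' := e.trans (Submodule.quotEquivOfEq _ _ heq)
  have h3 := projectiveDimension_eq_of_iso e'.toModuleIso
  have h4 : projectiveDimension ((ModuleCat.of S (S ⧸ P)).localizedModule P.primeCompl) = N :=
    h3.trans hpd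
  rw [h4] at h2
  exact absurd (h2.trans_lt h1) (lt_irrefl _)

end Lower

section KerMono
variable {K : Type*} [Field K] {σ τ : Type*} [Fintype σ]

lemma map_monomial_of_X (θ : MvPolynomial σ K →ₐ[K] MvPolynomial τ K) (w : σ → τ →₀ ℕ)
    (hθ : ∀ s, θ (X s) = monomial (w s) 1) (α : σ →₀ ℕ) :
    θ (monomial α 1) = monomial (∑ s, α s • w s) 1 := by
  rw [monomial_eq, map_mul, Finsupp.prod_fintype _ _ (by simp), map_prod]
  simp only [map_pow, hθ, monomial_pow, one_pow, map_one, one_mul]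
  rw [monomial_sum_one]

/-- The kernel of a monomial map is any ideal that contains enough binomials. -/
lemma ker_monomial_map (θ : MvPolynomial σ K →ₐ[K] MvPolynomial τ K) (w : σ → τ →₀ ℕ)
    (hθ : ∀ s, θ (X s) = monomial (w s) 1) (J : Ideal (MvPolynomial σ K))
    (hJ : J ≤ RingHom.ker θ)
    (h : ∀ α β : σ →₀ ℕ, ∑ s, α s • w s = ∑ s, β s • w s →
      Ideal.Quotient.mk J (monomial α 1) = Ideal.Quotient.mk J (monomial β 1)) :
    RingHom.ker θ = J := by
  apply le_antisymm _ hJ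
  let g : (τ →₀ ℕ) → MvPolynomial σ K ⧸ J := fun t =>
    if h : ∃ α : σ →₀ ℕ, ∑ s, α s • w s = t then Ideal.Quotient.mk J (monomial h.choose 1) else 0
  let G : MvPolynomial τ K →ₗ[K] MvPolynomial σ K ⧸ J := (basisMonomials τ K).constr K g
  have hG : G ∘ₗ θ.toLinearMap = (Ideal.Quotient.mkₐ K J).toLinearMap := by
    apply (basisMonomials σ K).ext
    intro α
    have h1 : ∃ α' : σ →₀ ℕ, ∑ s, α' s • w s = ∑ s, α s • w s := ⟨α, rfl⟩
    have h2 : G (monomial (∑ s, α s • w s) 1) = g (∑ s, α s • w s) := by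
      have := (basisMonomials τ K).constr_basis K g (∑ s, α s • w s)
      rwa [coe_basisMonomials] at this
    simp only [coe_basisMonomials, LinearMap.comp_apply, AlgHom.toLinearMap_apply,
      map_monomial_of_X θ w hθ, h2, g, dif_pos h1]
    exact h _ _ h1.choose_spec
  intro x hx
  have h3 : θ x = 0 := hx
  have h4 := LinearMap.congr_fun hG x
  simp only [LinearMap.comp_apply, AlgHom.toLinearMap_apply, h3, map_zero] at h4
  exact Ideal.Quotient.eq_zero_iff_mem.1 h4.symm

end KerMono

section Comb
variable {n : ℕ}

/-- Edges: `a i`, `b i`, and `p, q, r, s, h, f, g`. -/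
abbrev Ed (n : ℕ) : Type := Fin n ⊕ Fin n ⊕ Fin 7
/-- Columns of the matrix. -/
abbrev Col (n : ℕ) : Type := Fin n ⊕ Bool

abbrev ep : Ed n := Sum.inr (Sum.inr 0)
abbrev eq : Ed n := Sum.inr (Sum.inr 1)
abbrev er : Ed n := Sum.inr (Sum.inr 2)
abbrev es : Ed n := Sum.inr (Sum.inr 3)
abbrev eh : Ed n := Sum.inr (Sum.inr 4)
abbrev ef : Ed n := Sum.inr (Sum.inr 5)
abbrev eg : Ed n := Sum.inr (Sum.inr 6)

/-- Exponents of the upper entry of a column. -/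
def up : Col n → Ed n → ℕ
  | Sum.inl i => Pi.single (Sum.inl i) 1
  | Sum.inr false => Pi.single ep 1 + Pi.single eq 1
  | Sum.inr true => Pi.single ef 1 + Pi.single er 1

/-- Exponents of the lower entry of a column. -/
def dn : Col n → Ed n → ℕ
  | Sum.inl i => Pi.single (Sum.inr (Sum.inl i)) 1
  | Sum.inr false => Pi.single er 1 + Pi.single es 1
  | Sum.inr true => Pi.single eg 1 + Pi.single eh 1

/-- The position of a column. -/
def idx : Col n → ℕ
  | Sum.inl i => i
  | Sum.inr false => n
  | Sum.inr true => n + 1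

/-- The column in a position. -/
def col (n : ℕ) (j : ℕ) : Col n :=
  if h : j < n then Sum.inl ⟨j, h⟩ else if j = n then Sum.inr false else Sum.inr true

lemma idx_col {j : ℕ} (hj : j ≤ n + 1) : idx (col n j) = j := by
  unfold col
  split_ifs with h1 h2
  · rfl
  · simp [idx, h2]
  · simp only [idx]; omega

lemma idx_lt (c : Col n) : idx c < n + 2 := by
  rcases c with i | (_ | _) <;> simp only [idx] <;> omega

lemma col_idx (c : Col n) : col n (idx c) = c := by
  rcases c with i | (_ | _) <;> simp [idx, col]

/-- A monomial in given elements. -/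
def mon {A : Type*} [CommRing A] (y : Ed n → A) (α : Ed n → ℕ) : A := ∏ e, y e ^ α e

lemma mon_add {A : Type*} [CommRing A] (y : Ed n → A) (α β : Ed n → ℕ) :
    mon y (α + β) = mon y α * mon y β := by
  simp [mon, pow_add, Finset.prod_mul_distrib]

lemma mon_single {A : Type*} [CommRing A] (y : Ed n → A) (e : Ed n) :
    mon y (Pi.single e 1) = y e := by
  unfold mon
  rw [Finset.prod_eq_single e]
  · simp
  · intro b _ hb
    simp [hb]
  · simp

lemma le_seven {γ α : Ed n → ℕ} (h1 : ∀ i, γ (Sum.inl i) ≤ α (Sum.inl i))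
    (h2 : ∀ i, γ (Sum.inr (Sum.inl i)) ≤ α (Sum.inr (Sum.inl i)))
    (h3 : γ ep ≤ α ep ∧ γ eq ≤ α eq ∧ γ er ≤ α er ∧ γ es ≤ α es ∧ γ eh ≤ α eh ∧ γ ef ≤ α ef ∧
      γ eg ≤ α eg) : γ ≤ α := by
  obtain ⟨h3, h4, h5, h6, h7, h8, h9⟩ := h3
  rintro (i | i | x)
  · exact h1 i
  · exact h2 i
  · fin_cases x <;> assumption

/-- The existence of a move. -/
lemma exists_move (ε : Col n → ℤ) (hsum : ∑ c, ε c = 0) (hne : ∃ c, ε c ≠ 0)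
    (α β : Ed n → ℕ)
    (hd : ∀ e, (α e : ℤ) = β e + ∑ c, ε c * ((up c e : ℤ) - dn c e)) :
    ∃ c c', 0 < ε c ∧ ε c' < 0 ∧ up c + dn c' ≤ α := by
  have ha : ∀ i : Fin n, (α (Sum.inl i) : ℤ) = β (Sum.inl i) + ε (Sum.inl i) := by
    intro i
    rw [hd]
    simp [up, dn, Pi.single_apply]
  have hb : ∀ i : Fin n, (α (Sum.inr (Sum.inl i)) : ℤ) =
      β (Sum.inr (Sum.inl i)) - ε (Sum.inl i) := by
    intro i
    rw [hd]
    simp [up, dn, Pi.single_apply]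
    ring
  have hp := hd ep
  have hq := hd eq
  have hr := hd er
  have hs := hd es
  have hh := hd eh
  have hf := hd ef
  have hg := hd eg
  simp [up, dn] at hp hq hr hs hh hf hg
  set κ := ε (Sum.inr false) with hκ
  set φ := ε (Sum.inr true) with hφ
  have hsum' : ∑ i : Fin n, ε (Sum.inl i) + (φ + κ) = 0 := by
    rw [← hsum, Fintype.sum_sum_type, Fintype.sum_bool]
  -- a positive column among the first ones, or no such column
  have hpos : (∃ i : Fin n, 0 < ε (Sum.inl i)) ∨ 0 < κ ∨ 0 < φ := by
    by_contra! hcon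
    obtain ⟨h1, h2, h3⟩ := hcon
    have h4 : ∑ i : Fin n, ε (Sum.inl i) ≤ 0 := Finset.sum_nonpos (fun i _ => h1 i)
    have h5 : ∑ i : Fin n, ε (Sum.inl i) = 0 := by omega
    rw [Finset.sum_eq_zero_iff_of_nonpos (fun i _ => h1 i)] at h5
    obtain ⟨c, hc⟩ := hne
    rcases c with i | (_ | _)
    · exact hc (h5 i (Finset.mem_univ _))
    · exact hc (by omega)
    · exact hc (by omega)
  have hneg : (∃ i : Fin n, ε (Sum.inl i) < 0) ∨ κ < 0 ∨ φ < 0 := by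
    by_contra! hcon
    obtain ⟨h1, h2, h3⟩ := hcon
    have h4 : 0 ≤ ∑ i : Fin n, ε (Sum.inl i) := Finset.sum_nonneg (fun i _ => h1 i)
    have h5 : ∑ i : Fin n, ε (Sum.inl i) = 0 := by omega
    rw [Finset.sum_eq_zero_iff_of_nonneg (fun i _ => h1 i)] at h5
    obtain ⟨c, hc⟩ := hne
    rcases c with i | (_ | _)
    · exact hc (h5 i (Finset.mem_univ _))
    · exact hc (by omega)
    · exact hc (by omega)
  by_cases hκ0 : 0 < κ
  · by_cases hφ0 : φ < 0
    · refine ⟨Sum.inr false, Sum.inr true, hκ0, hφ0, ?_⟩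
      refine le_seven (fun i => ?_) (fun i => ?_) ?_
      · simp [up, dn]
      · simp [up, dn]
      · refine ⟨?_, ?_, ?_, ?_, ?_, ?_, ?_⟩ <;> simp [up, dn] <;> omega
    · obtain ⟨j, hj⟩ : ∃ i : Fin n, ε (Sum.inl i) < 0 := by
        rcases hneg with h | h | h
        · exact h
        · omega
        · omega
      have := hb j
      refine ⟨Sum.inr false, Sum.inl j, hκ0, hj, ?_⟩
      refine le_seven (fun i => ?_) (fun i => ?_) ?_
      · simp [up, dn]
      · by_cases hij : i = j
        · subst hij; simp [up, dn]; omega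
        · simp [up, dn, hij]
      · refine ⟨?_, ?_, ?_, ?_, ?_, ?_, ?_⟩ <;> simp [up, dn] <;> omega
  · by_cases hi : ∃ i : Fin n, 0 < ε (Sum.inl i)
    · obtain ⟨i₀, hi₀⟩ := hi
      have hai := ha i₀
      by_cases hφ0 : φ < 0
      · refine ⟨Sum.inl i₀, Sum.inr true, hi₀, hφ0, ?_⟩
        refine le_seven (fun i => ?_) (fun i => ?_) ?_
        · by_cases hij : i = i₀
          · subst hij; simp [up, dn]; omega
          · simp [up, dn, hij]
        · simp [up, dn]
        · refine ⟨?_, ?_, ?_, ?_, ?_, ?_, ?_⟩ <;> simp [up, dn] <;> omega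
      · by_cases hj : ∃ i : Fin n, ε (Sum.inl i) < 0
        · obtain ⟨j, hj⟩ := hj
          have hbj := hb j
          refine ⟨Sum.inl i₀, Sum.inl j, hi₀, hj, ?_⟩
          refine le_seven (fun i => ?_) (fun i => ?_) ?_
          · by_cases hij : i = i₀
            · subst hij; simp [up, dn]; omega
            · simp [up, dn, hij]
          · by_cases hij : i = j
            · subst hij; simp [up, dn]; omega
            · simp [up, dn, hij]
          · simp [up, dn]
        · have hκ1 : κ < 0 := by
            rcases hneg with h | h | h
            · exact absurd h hj
            · exact h
            · omega
          refine ⟨Sum.inl i₀, Sum.inr false, hi₀, hκ1, ?_⟩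
          refine le_seven (fun i => ?_) (fun i => ?_) ?_
          · by_cases hij : i = i₀
            · subst hij; simp [up, dn]; omega
            · simp [up, dn, hij]
          · simp [up, dn]
          · refine ⟨?_, ?_, ?_, ?_, ?_, ?_, ?_⟩ <;> simp [up, dn] <;> omega
    · have hφ1 : 0 < φ := by
        rcases hpos with h | h | h
        · exact absurd h hi
        · omega
        · exact h
      by_cases hj : ∃ i : Fin n, ε (Sum.inl i) < 0
      · obtain ⟨j, hj⟩ := hj
        have hbj := hb j
        refine ⟨Sum.inr true, Sum.inl j, hφ1, hj, ?_⟩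
        refine le_seven (fun i => ?_) (fun i => ?_) ?_
        · simp [up, dn]
        · by_cases hij : i = j
          · subst hij; simp [up, dn]; omega
          · simp [up, dn, hij]
        · refine ⟨?_, ?_, ?_, ?_, ?_, ?_, ?_⟩ <;> simp [up, dn] <;> omega
      · have hκ1 : κ < 0 := by
          rcases hneg with h | h | h
          · exact absurd h hj
          · exact h
          · omega
        refine ⟨Sum.inr true, Sum.inr false, hφ1, hκ1, ?_⟩
        refine le_seven (fun i => ?_) (fun i => ?_) ?_
        · simp [up, dn]
        · simp [up, dn]
        · refine ⟨?_, ?_, ?_, ?_, ?_, ?_, ?_⟩ <;> simp [up, dn] <;> omega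

lemma mon_eq_of_diff {A : Type*} [CommRing A] (y : Ed n → A) (T : Set (Col n))
    (H : ∀ c ∈ T, ∀ c' ∈ T, mon y (up c) * mon y (dn c') = mon y (up c') * mon y (dn c))
    (β : Ed n → ℕ) (N : ℕ) : ∀ (ε : Col n → ℤ) (α : Ed n → ℕ), ∑ c, (ε c).natAbs = N →
      (∀ c, ε c ≠ 0 → c ∈ T) → ∑ c, ε c = 0 →
      (∀ e, (α e : ℤ) = β e + ∑ c, ε c * ((up c e : ℤ) - dn c e)) → mon y α = mon y β := by
  induction N using Nat.strong_induction_on with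
  | _ N ih =>
    intro ε α hN hT hsum hd
    by_cases hne : ∃ c, ε c ≠ 0
    · obtain ⟨c, c', hc, hc', hle⟩ := exists_move ε hsum hne α β hd
      have hcc : c ≠ c' := by rintro rfl; omega
      obtain ⟨γ, hγ⟩ := exists_add_of_le hle
      have h1 : mon y α = mon y (up c' + dn c + γ) := by
        rw [hγ, mon_add, mon_add, mon_add y (_ + _) γ, mon_add,
          H c (hT c (by omega)) c' (hT c' (by omega))]
      rw [h1]
      refine ih _ ?_ (ε - Pi.single c 1 + Pi.single c' 1) _ rfl ?_ ?_ ?_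
      · rw [← hN]
        apply Finset.sum_lt_sum
        · intro x _
          by_cases hx : x = c
          · subst hx; simp [hcc]; omega
          · by_cases hx' : x = c'
            · subst hx'; simp [hx]; omega
            · simp [hx, hx']
        · exact ⟨c, Finset.mem_univ _, by simp [hcc]; omega⟩
      · intro x hx
        by_cases hxc : x = c
        · subst hxc; exact hT _ (by omega)
        · by_cases hx' : x = c'
          · subst hx'; exact hT _ (by omega)
          · exact hT _ (by simpa [hxc, hx'] using hx)
      · simp [Finset.sum_add_distrib, Finset.sum_sub_distrib, hsum]
      · intro e
        have h2 := hd e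
        have h3 : (α e : ℤ) = up c e + dn c' e + γ e := by rw [hγ]; simp
        have h4 : ∑ x, (ε - Pi.single c 1 + Pi.single c' 1 : Col n → ℤ) x * ((up x e : ℤ) - dn x e) =
            ∑ x, ε x * ((up x e : ℤ) - dn x e) - ((up c e : ℤ) - dn c e) +
              ((up c' e : ℤ) - dn c' e) := by
          simp only [Pi.add_apply, Pi.sub_apply, add_mul, sub_mul, Finset.sum_add_distrib,
            Finset.sum_sub_distrib]
          simp [Pi.single_apply]
        rw [h4]
        simp only [Pi.add_apply]
        push_cast
        linarith
    · push Not at hne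
      congr 1
      funext e
      have := hd e
      simp only [hne, zero_mul, Finset.sum_const_zero, add_zero] at this
      exact_mod_cast this

end Comb

section Weights
variable {n : ℕ}

/-- Vertices. -/
abbrev Vt (n : ℕ) : Type := Fin 6 ⊕ Fin n

/-- First endpoint of an edge. -/
def src : Ed n → Vt n
  | Sum.inl _ => Sum.inl 0
  | Sum.inr (Sum.inl _) => Sum.inl 1
  | Sum.inr (Sum.inr x) => Sum.inl ((![0, 4, 2, 1, 1, 0, 2] : Fin 7 → Fin 6) x)

/-- Second endpoint of an edge. -/
def tgt : Ed n → Vt n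
  | Sum.inl i => Sum.inr i
  | Sum.inr (Sum.inl i) => Sum.inr i
  | Sum.inr (Sum.inr x) => Sum.inl ((![2, 5, 4, 5, 4, 3, 3] : Fin 7 → Fin 6) x)

/-- The variable detecting a column. -/
def top' : Col n → Ed n
  | Sum.inl i => Sum.inl i
  | Sum.inr false => ep
  | Sum.inr true => ef

/-- Incidence. -/
def inc (e : Ed n) (v : Vt n) : ℕ := (if v = src e then 1 else 0) + (if v = tgt e then 1 else 0)

/-- The weight of an edge: its endpoints, and an extra variable for the columns `≥ k`. -/
def wt (k : ℕ) (e : Ed n) : Vt n ⊕ Col n →₀ ℕ :=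
  Finsupp.equivFunOnFinite.symm (Sum.elim (inc e) (fun c => if k ≤ idx c ∧ e = top' c then 1 else 0))

lemma wt_inl (k : ℕ) (e : Ed n) (v : Vt n) : wt k e (Sum.inl v) = inc e v := rfl
lemma wt_inr (k : ℕ) (e : Ed n) (c : Col n) :
    wt k e (Sum.inr c) = if k ≤ idx c ∧ e = top' c then 1 else 0 := rfl

/-- Total weight of an exponent vector. -/
def tw (k : ℕ) (α : Ed n → ℕ) : Vt n ⊕ Col n →₀ ℕ := ∑ e, α e • wt k e

lemma tw_add (k : ℕ) (α β : Ed n → ℕ) : tw k (α + β) = tw k α + tw k β := by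
  simp [tw, add_smul, Finset.sum_add_distrib]

lemma tw_inl (k : ℕ) (α : Ed n → ℕ) (v : Vt n) :
    tw k α (Sum.inl v) = ∑ e, α e * inc e v := by
  simp [tw, wt_inl]

lemma tw_inr (k : ℕ) (α : Ed n → ℕ) (c : Col n) :
    tw k α (Sum.inr c) = if k ≤ idx c then α (top' c) else 0 := by
  simp only [tw, Finsupp.finsetSum_apply, Finsupp.smul_apply, wt_inr, smul_eq_mul]
  split_ifs with h
  · simp [h]
  · simp [h]

lemma up_top (c c' : Col n) : up c (top' c') = if c = c' then 1 else 0 := by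
  rcases c with i | (_ | _) <;> rcases c' with j | (_ | _) <;>
    simp [up, top', Pi.single_apply, _root_.eq_comm]

lemma dn_top (c c' : Col n) : dn c (top' c') = 0 := by
  rcases c with i | (_ | _) <;> rcases c' with j | (_ | _) <;>
    simp [dn, top']

lemma up_dn_inc (c : Col n) (v : Vt n) :
    ∑ e, up c e * inc e v + (if v = Sum.inl 1 then 1 else 0) =
      ∑ e, dn c e * inc e v + (if v = Sum.inl 0 then 1 else 0) := by
  rcases v with v | j
  · fin_cases v <;> rcases c with i | (_ | _) <;>
      simp [up, dn, Pi.single_apply, inc, src, tgt, add_mul, Finset.sum_add_distrib]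
  · rcases c with i | (_ | _) <;>
      simp [up, dn, Pi.single_apply, inc, src, tgt, add_mul, Finset.sum_add_distrib]

lemma tw_swap (k : ℕ) (c c' : Col n) (hc : idx c < k) (hc' : idx c' < k) :
    tw k (up c + dn c') = tw k (up c' + dn c) := by
  ext t
  rcases t with v | x
  · simp only [tw_add, Finsupp.add_apply, tw_inl]
    have h1 := up_dn_inc c v
    have h2 := up_dn_inc c' v
    omega
  · simp only [tw_inr, Pi.add_apply, up_top, dn_top]
    split_ifs with h1 h2 h3 h3 <;> first | rfl | (subst_vars; omega)

/-- Exponent vectors of the same weight differ by an element of the lattice. -/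
lemma exists_eps (k : ℕ) (α β : Ed n → ℕ) (h : tw k α = tw k β) :
    ∃ ε : Col n → ℤ, (∀ c, ε c ≠ 0 → idx c < k) ∧ ∑ c, ε c = 0 ∧
      ∀ e, (α e : ℤ) = β e + ∑ c, ε c * ((up c e : ℤ) - dn c e) := by
  have hv : ∀ v : Vt n, (∑ e, α e * inc e v) = ∑ e, β e * inc e v := by
    intro v
    rw [← tw_inl k, ← tw_inl k, h]
  have hu : ∀ i : Fin n, α (Sum.inl i) + α (Sum.inr (Sum.inl i)) =
      β (Sum.inl i) + β (Sum.inr (Sum.inl i)) := by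
    intro i
    have := hv (Sum.inr i)
    simpa [inc, src, tgt] using this
  have h0 := hv (Sum.inl 0)
  have h1 := hv (Sum.inl 1)
  have h2 := hv (Sum.inl 2)
  have h3 := hv (Sum.inl 3)
  have h4 := hv (Sum.inl 4)
  have h5 := hv (Sum.inl 5)
  simp [inc, src, tgt, Fin.sum_univ_seven] at h0 h1 h2 h3 h4 h5
  have hsu : ∑ i : Fin n, α (Sum.inl i) + ∑ i : Fin n, α (Sum.inr (Sum.inl i)) =
      ∑ i : Fin n, β (Sum.inl i) + ∑ i : Fin n, β (Sum.inr (Sum.inl i)) := by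
    rw [← Finset.sum_add_distrib, ← Finset.sum_add_distrib]
    exact Finset.sum_congr rfl (fun i _ => hu i)
  refine ⟨fun c => (α (top' c) : ℤ) - β (top' c), ?_, ?_, ?_⟩
  · intro c hc
    by_contra hk
    have := congrArg (fun f => f (Sum.inr c)) h
    simp only [tw_inr, if_pos (not_lt.1 hk)] at this
    dsimp only at hc
    omega
  · simp [top']
    zify at h0
    linarith
  · rintro (i | i | x)
    · simp [up, dn, Pi.single_apply, top']
    · simp [up, dn, Pi.single_apply, top']
      have := hu i
      omega
    · revert x
      simp only [Fin.forall_fin_succ, IsEmpty.forall_iff, and_true]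
      refine ⟨?_, ?_, ?_, ?_, ?_, ?_, ?_⟩
      all_goals
        simp [up, dn, top']
        try simp only [ep, ef]
        try omega

end Weights

section Main
universe u
variable (K : Type u) [Field K] {σ : Type} [Fintype σ] {n : ℕ} (ι : σ → Ed n)

/-- The variables, extended by `1`. -/
def yv : Ed n → MvPolynomial σ K := Function.extend ι X 1

/-- The weighted monomial map. -/
def thet (k : ℕ) : MvPolynomial σ K →ₐ[K] MvPolynomial (Vt n ⊕ Col n) K :=
  aeval (fun s => monomial (wt k (ι s)) 1)

/-- Upper row of the matrix. -/
def cc (j : ℕ) : MvPolynomial σ K := mon (yv K ι) (up (col n j))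
/-- Lower row of the matrix. -/
def dd (j : ℕ) : MvPolynomial σ K := mon (yv K ι) (dn (col n j))

variable {ι}

lemma mon_extend (α : σ →₀ ℕ) (hι : Function.Injective ι) :
    mon (yv K ι) (Function.extend ι α 0) = monomial α 1 := by
  rw [monomial_eq, Finsupp.prod_fintype _ _ (by simp), C_1, one_mul, mon]
  symm
  apply Fintype.prod_of_injective ι hι
  · intro e he
    rw [Function.extend_apply' _ _ _ (by simpa using he)]
    simp
  · intro s
    rw [yv, hι.extend_apply, hι.extend_apply]

lemma tw_extend (k : ℕ) (α : σ →₀ ℕ) (hι : Function.Injective ι) :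
    tw k (Function.extend ι α 0) = ∑ s, α s • wt k (ι s) := by
  rw [tw]
  symm
  apply Fintype.sum_of_injective ι hι
  · intro e he
    rw [Function.extend_apply' _ _ _ (by simpa using he)]
    simp
  · intro s
    rw [hι.extend_apply]

lemma thet_mon (k : ℕ) (γ : Ed n → ℕ) (hι : Function.Injective ι)
    (hγ : ∀ e, γ e ≠ 0 → e ∈ Set.range ι) :
    thet K ι k (mon (yv K ι) γ) = monomial (tw k γ) 1 := by
  have h1 : γ = Function.extend ι (Finsupp.equivFunOnFinite.symm (γ ∘ ι) : σ →₀ ℕ) 0 := by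
    funext e
    by_cases he : e ∈ Set.range ι
    · obtain ⟨s, rfl⟩ := he
      rw [hι.extend_apply]
      rfl
    · rw [Function.extend_apply' _ _ _ (by simpa using he)]
      by_contra h
      exact he (hγ e h)
  rw [h1, mon_extend K _ hι, tw_extend k _ hι]
  exact map_monomial_of_X _ _ (fun s => by simp [thet]) _

lemma isPrime_span_X_image (s : Set σ) :
    (Ideal.span (X '' s : Set (MvPolynomial σ K))).IsPrime := by
  let ev : MvPolynomial σ K →ₐ[K] MvPolynomial σ K := aeval (fun i => if i ∈ s then 0 else X i)
  have h : Ideal.span (X '' s : Set (MvPolynomial σ K)) = RingHom.ker ev := by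
    apply le_antisymm
    · rw [Ideal.span_le]
      rintro _ ⟨i, hi, rfl⟩
      simp [ev, RingHom.mem_ker, hi]
    · intro x hx
      have h1 : (Ideal.Quotient.mkₐ K (Ideal.span (X '' s : Set (MvPolynomial σ K)))).comp ev =
          Ideal.Quotient.mkₐ K _ := by
        apply algHom_ext
        intro i
        by_cases hi : i ∈ s
        · simp only [AlgHom.comp_apply, ev, aeval_X, if_pos hi, map_zero]
          symm
          exact Ideal.Quotient.eq_zero_iff_mem.2 (Ideal.subset_span ⟨i, hi, rfl⟩)
        · simp [ev, hi]
      have h2 := DFunLike.congr_fun h1 x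
      have h3 : ev x = 0 := hx
      rw [AlgHom.comp_apply, h3, map_zero] at h2
      exact Ideal.Quotient.eq_zero_iff_mem.1 h2.symm
  rw [h]
  exact RingHom.ker_isPrime _

section
variable {N : ℕ}

lemma thet_cd (hN : N ≤ n + 1) (hι : Function.Injective ι)
    (hr : ∀ c : Col n, idx c ≤ N → ∀ e, up c e + dn c e ≠ 0 → e ∈ Set.range ι)
    (k i j : ℕ) (hi : i ≤ N) (hj : j ≤ N) :
    thet K ι k (cc K ι i * dd K ι j) = monomial (tw k (up (col n i) + dn (col n j))) 1 := by
  rw [cc, dd, ← mon_add]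
  apply thet_mon K k _ hι
  intro e he
  by_cases h : up (col n i) e = 0
  · refine hr (col n j) (by rw [idx_col (by omega)]; exact hj) e ?_
    simp only [Pi.add_apply] at he
    omega
  · exact hr (col n i) (by rw [idx_col (by omega)]; exact hi) e (by omega)

lemma ker_thet (hN : N ≤ n + 1) (hι : Function.Injective ι)
    (hr : ∀ c : Col n, idx c ≤ N → ∀ e, up c e + dn c e ≠ 0 → e ∈ Set.range ι)
    (k : ℕ) (hk : k ≤ N + 1) :
    RingHom.ker (thet K ι k) = minorIdeal (cc K ι) (dd K ι) k := by
  apply ker_monomial_map _ (fun s => wt k (ι s)) (fun s => by simp [thet])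
  · rw [minorIdeal, Ideal.span_le]
    rintro x ⟨i, j, hi, hj, rfl⟩
    rw [SetLike.mem_coe, RingHom.mem_ker, dt, map_sub, thet_cd K hN hι hr k i j (by omega) (by omega),
      thet_cd K hN hι hr k j i (by omega) (by omega), tw_swap k, sub_self]
    · rw [idx_col (by omega)]; exact hi
    · rw [idx_col (by omega)]; exact hj
  · intro α β h
    rw [← tw_extend k α hι, ← tw_extend k β hι] at h
    obtain ⟨ε, h1, h2, h3⟩ := exists_eps k _ _ h
    have hmk : ∀ γ : Ed n → ℕ, Ideal.Quotient.mk (minorIdeal (cc K ι) (dd K ι) k)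
        (mon (yv K ι) γ) = mon (fun e => Ideal.Quotient.mk _ (yv K ι e)) γ := by
      intro γ
      simp [mon]
    rw [← mon_extend K α hι, ← mon_extend K β hι, hmk, hmk]
    refine mon_eq_of_diff _ {c | idx c < k} ?_ _ _ ε _ rfl h1 h2 h3
    intro c hc c' hc'
    rw [← hmk, ← hmk, ← hmk, ← hmk, ← map_mul, ← map_mul, Ideal.Quotient.eq]
    have := dt_mem (cc K ι) (dd K ι) (show idx c < k from hc) (show idx c' < k from hc')
    simpa only [dt, cc, dd, col_idx] using this

lemma cc_notMem (hN : N ≤ n + 1) (hι : Function.Injective ι)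
    (hr : ∀ c : Col n, idx c ≤ N → ∀ e, up c e + dn c e ≠ 0 → e ∈ Set.range ι)
    (k : ℕ) (hk : k ≤ N + 1) : cc K ι 0 ∉ minorIdeal (cc K ι) (dd K ι) k := by
  rw [← ker_thet K hN hι hr k hk, RingHom.mem_ker]
  intro h
  have := thet_cd K hN hι hr k 0 0 (by omega) (by omega)
  rw [map_mul, h, zero_mul] at this
  exact one_ne_zero (monomial_eq_zero.1 this.symm)

lemma dt_notMem (hN : N ≤ n + 1) (hι : Function.Injective ι)
    (hr : ∀ c : Col n, idx c ≤ N → ∀ e, up c e + dn c e ≠ 0 → e ∈ Set.range ι)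
    (k : ℕ) (hk0 : 1 ≤ k) (hk : k ≤ N) :
    dt (cc K ι) (dd K ι) 0 k ∉ minorIdeal (cc K ι) (dd K ι) k := by
  rw [← ker_thet K hN hι hr k (by omega), RingHom.mem_ker, dt, map_sub, sub_eq_zero,
    thet_cd K hN hι hr k 0 k (by omega) hk, thet_cd K hN hι hr k k 0 hk (by omega)]
  intro h
  have h1 := (monomial_left_inj (one_ne_zero)).1 h
  have h2 := congrArg (fun f => f (Sum.inr (col n k))) h1
  have h3 : col n 0 ≠ col n k := by
    intro h
    have := congrArg idx h
    rw [idx_col (by omega), idx_col (by omega)] at this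
    omega
  simp [tw_inr, idx_col (show k ≤ n + 1 by omega), up_top, dn_top, h3] at h2

lemma cc_reg (hN : N ≤ n + 1) (hι : Function.Injective ι)
    (hr : ∀ c : Col n, idx c ≤ N → ∀ e, up c e + dn c e ≠ 0 → e ∈ Set.range ι)
    (k : ℕ) (hk : k < N) (y : MvPolynomial σ K) (hy : cc K ι k * y ∈ rowIdeal (cc K ι) k) :
    y ∈ rowIdeal (cc K ι) k := by
  have hrow : rowIdeal (cc K ι) k =
      Ideal.span (X '' {s : σ | ∃ i : Fin n, (i : ℕ) < k ∧ ι s = Sum.inl i}) := by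
    rw [rowIdeal]
    congr 1
    ext x
    constructor
    · rintro ⟨i, hi, rfl⟩
      have hi' : i < k := hi
      have hin : i < n := by omega
      obtain ⟨s, hs⟩ := hr (Sum.inl ⟨i, hin⟩) (by simp only [idx]; omega) (Sum.inl ⟨i, hin⟩)
        (by simp [up])
      refine ⟨s, ⟨⟨i, hin⟩, hi', hs⟩, ?_⟩
      rw [cc, col, dif_pos hin, up, mon_single, ← hs, yv, hι.extend_apply]
    · rintro ⟨s, ⟨i, hi, hs⟩, rfl⟩
      refine ⟨i, hi, ?_⟩
      rw [cc, col, dif_pos i.2, up, mon_single, ← hs, yv, hι.extend_apply]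
  have hpr : (rowIdeal (cc K ι) k).IsPrime := by
    rw [hrow]
    exact isPrime_span_X_image K _
  refine (hpr.mem_or_mem hy).resolve_left ?_
  have hX : ∀ s : σ, (∀ i : Fin n, (i : ℕ) < k → ι s ≠ Sum.inl i) →
      (X s : MvPolynomial σ K) ∉ rowIdeal (cc K ι) k := by
    intro s hs hmem
    rw [hrow, mem_ideal_span_X_image] at hmem
    obtain ⟨t, ⟨i, hi, ht⟩, hne⟩ := hmem (Finsupp.single s 1) (by simp [support_X])
    have : s = t := by
      by_contra hst
      exact hne (by simp [hst])
    subst this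
    exact hs i hi ht
  by_cases hkn : k < n
  · obtain ⟨s, hs⟩ := hr (Sum.inl ⟨k, hkn⟩) (by simp only [idx]; omega) (Sum.inl ⟨k, hkn⟩)
        (by simp [up])
    rw [cc, col, dif_pos hkn, up, mon_single, ← hs, yv, hι.extend_apply]
    apply hX
    intro i hi h
    rw [hs] at h
    have := congrArg Fin.val (Sum.inl_injective h)
    simp at this
    omega
  · have hkn' : k = n := by omega
    obtain ⟨s, hs⟩ := hr (Sum.inr false) (by simp only [idx]; omega) ep (by simp [up])
    obtain ⟨t, ht⟩ := hr (Sum.inr false) (by simp only [idx]; omega) eq (by simp [up])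
    rw [cc, col, dif_neg hkn, if_pos hkn', up, mon_add, mon_single, mon_single, ← hs, ← ht, yv,
      hι.extend_apply, hι.extend_apply]
    intro h
    rcases hpr.mem_or_mem h with h | h
    · exact hX s (by simp [hs]) h
    · exact hX t (by simp [ht]) h

/-- The projective dimension in the abstract situation. -/
theorem projDim_main (hN : N ≤ n + 1) (hι : Function.Injective ι)
    (hr : ∀ c : Col n, idx c ≤ N → ∀ e, up c e + dn c e ≠ 0 → e ∈ Set.range ι)
    (J : Ideal (MvPolynomial σ K)) (hJ : J = RingHom.ker (thet K ι (N + 1))) :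
    projDim (MvPolynomial σ K) (ModuleCat.of _ (MvPolynomial σ K ⧸ J)) = N := by
  rw [ker_thet K hN hι hr (N + 1) le_rfl] at hJ
  subst hJ
  have hprime : ∀ k, 1 ≤ k → k ≤ N + 1 → (minorIdeal (cc K ι) (dd K ι) k).IsPrime := by
    intro k _ hk
    rw [← ker_thet K hN hι hr k hk]
    exact RingHom.ker_isPrime _
  apply projDim_eq
  · exact pdLT_minorIdeal (cc K ι) (dd K ι) N (fun k h1 h2 => hprime k h1 (by omega))
      (fun k _ h2 => cc_notMem K hN hι hr k (by omega))
      (fun k h1 h2 => dt_notMem K hN hι hr k h1 h2)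
      (fun k hk y hy => cc_reg K hN hι hr k hk y hy) N le_rfl
  · exact not_pdLT_minorIdeal (cc K ι) (dd K ι) N hprime (cc_notMem K hN hι hr (N + 1) le_rfl)
      (fun k h1 h2 => dt_notMem K hN hι hr k h1 h2)

end
end Main

section Graph
variable {n : ℕ}

lemma ends_inj (x y : Ed n) (h : s(src x, tgt x) = s(src y, tgt y)) : x = y := by
  rcases x with i | i | x <;> rcases y with j | j | y
  · simpa [src, tgt] using h
  · simp [src, tgt] at h
  · simp [src, tgt] at h
  · simp [src, tgt] at h
  · simpa [src, tgt] using h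
  · simp [src, tgt] at h
  · simp [src, tgt] at h
  · simp [src, tgt] at h
  · simp only [src, tgt, Sym2.eq_iff, Sum.inl.injEq] at h
    have : x = y := by
      revert x y
      decide
    rw [this]

lemma twoEar_adj (m : ℕ) (x : Ed (m - 1)) : (twoEar m).Adj (src x) (tgt x) := by
  rw [twoEar, SimpleGraph.fromRel_adj]
  rcases x with i | i | x
  · simp [src, tgt, teRel]
  · simp [src, tgt, teRel]
  · simp only [src, tgt, teRel, ne_eq, Sum.inl.injEq]
    revert x
    decide

lemma teRel_ends (m : ℕ) (u v : TEV m) (h : teRel m u v) :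
    ∃ x : Ed (m - 1), s(u, v) = s(src x, tgt x) := by
  rcases u with a | i <;> rcases v with b | j
  · simp only [teRel] at h
    rcases h with ⟨rfl, rfl⟩ | ⟨rfl, rfl⟩ | ⟨rfl, rfl⟩ | ⟨rfl, rfl⟩ | ⟨rfl, rfl⟩ | ⟨rfl, rfl⟩ |
      ⟨rfl, rfl⟩
    · exact ⟨ep, rfl⟩
    · exact ⟨ef, rfl⟩
    · exact ⟨eg, rfl⟩
    · exact ⟨eh, rfl⟩
    · exact ⟨es, rfl⟩
    · exact ⟨eq, rfl⟩
    · exact ⟨er, rfl⟩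
  · simp only [teRel] at h
    rcases h with rfl | rfl
    · exact ⟨Sum.inl j, rfl⟩
    · exact ⟨Sum.inr (Sum.inl j), rfl⟩
  · exact h.elim
  · exact h.elim

lemma twoEar_ends (m : ℕ) (u v : TEV m) (h : (twoEar m).Adj u v) :
    ∃ x : Ed (m - 1), s(u, v) = s(src x, tgt x) := by
  rw [twoEar, SimpleGraph.fromRel_adj] at h
  rcases h.2 with h | h
  · exact teRel_ends m u v h
  · rw [Sym2.eq_swap]
    exact teRel_ends m v u h

lemma wt_eq (k : ℕ) (x : Ed n) (h : ∀ c, k ≤ idx c → x ≠ top' c) :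
    wt k x = Finsupp.single (Sum.inl (src x)) 1 + Finsupp.single (Sum.inl (tgt x)) 1 := by
  ext t
  rcases t with v | c
  · simp [wt_inl, inc, Finsupp.single_apply, _root_.eq_comm]
  · have : ¬ (k ≤ idx c ∧ x = top' c) := fun h' => h c h'.1 h'.2
    simp [wt_inr, this]

lemma rename_edgeMon (K : Type*) [Field K] {V W : Type*} (j : V → W) (e : Sym2 V) (u v : W)
    (h : Sym2.map j e = s(u, v)) :
    rename j (edgeMon K e) = (X u * X v : MvPolynomial W K) := by
  have h1 : rename j (edgeMon K e) = edgeMon K (Sym2.map j e) := by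
    induction e with
    | _ a b => simp [edgeMon]
  rw [h1, h]
  rfl

theorem projDim_graph (K : Type*) [Field K] {V : Type} [Finite V] (G : SimpleGraph V)
    (j : V → Vt n) (hj : Function.Injective j) (N : ℕ) (hN : N ≤ n + 1)
    (hends : ∀ e ∈ G.edgeSet, ∃ x : Ed n, Sym2.map j e = s(src x, tgt x))
    (htop : ∀ e ∈ G.edgeSet, ∀ c : Col n, N + 1 ≤ idx c →
      Sym2.map j e ≠ s(src (top' c), tgt (top' c)))
    (hr : ∀ c : Col n, idx c ≤ N → ∀ x, up c x + dn c x ≠ 0 →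
      ∃ e ∈ G.edgeSet, Sym2.map j e = s(src x, tgt x)) :
    projDim (MvPolynomial G.edgeSet K) (ModuleCat.of _ (edgeRing K G)) = (N : ℕ∞) := by
  have hfin : Fintype G.edgeSet := Fintype.ofFinite _
  choose ι hι using fun e : G.edgeSet => hends e e.2
  have hinj : Function.Injective ι := by
    intro e e' h
    apply Subtype.ext
    apply Sym2.map.injective hj
    rw [hι, hι, h]
  apply projDim_main K hN hinj
  · intro c hc x hx
    obtain ⟨e, he, hex⟩ := hr c hc x hx
    refine ⟨⟨e, he⟩, ends_inj _ _ ?_⟩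
    rw [← hι, ← hex]
  · have h1 : thet K ι (N + 1) = (rename (Sum.inl ∘ j)).comp (edgeHom K G) := by
      apply algHom_ext
      intro e
      have h2 : Sym2.map (Sum.inl ∘ j : V → Vt n ⊕ Col n) (e : Sym2 V) =
          s(Sum.inl (src (ι e)), Sum.inl (tgt (ι e))) := by
        rw [← Sym2.map_map, hι, Sym2.map_mk]
      rw [AlgHom.comp_apply, edgeHom, aeval_X, rename_edgeMon K _ _ _ _ h2, thet, aeval_X, wt_eq]
      · rw [X, X, monomial_mul, one_mul]
      · intro c hc h
        exact htop e e.2 c hc (by rw [hι, h])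
    ext x
    rw [h1, toricIdeal, RingHom.mem_ker, RingHom.mem_ker, AlgHom.comp_apply,
      map_eq_zero_iff _ (rename_injective _ (Sum.inl_injective.comp hj))]
    rfl

end Graph

/-- Projective dimensions of the edge rings of the two-ear and one-ear graphs. -/
theorem statement2 (K : Type*) [Field K] (m : ℕ) (hm : 1 ≤ m) :
    projDim (MvPolynomial (twoEar m).edgeSet K)
        (ModuleCat.of _ (edgeRing K (twoEar m))) = (m : ℕ∞) ∧
      projDim (MvPolynomial (oneEar m).edgeSet K)
        (ModuleCat.of _ (edgeRing K (oneEar m))) = ((m - 1 : ℕ) : ℕ∞) := by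
  constructor
  · apply projDim_graph (n := m - 1) K (twoEar m) id Function.injective_id m (by omega)
    · intro e
      induction e with
      | _ a b =>
        intro h
        exact twoEar_ends m a b h
    · intro e _ c hc
      have := idx_lt c
      omega
    · intro c _ x _
      exact ⟨s(src x, tgt x), twoEar_adj m x, rfl⟩
  · apply projDim_graph (n := m - 1) K (oneEar m) Subtype.val Subtype.val_injective (m - 1)
      (by omega)
    · intro e
      induction e with
      | _ a b =>
        intro h
        exact twoEar_ends m a b h
    · intro e _ c hc h
      rcases c with i | (_ | _)
      · simp only [idx] at hc
        omega
      · simp only [idx] at hc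
        omega
      · have h1 : (Sum.inl 3 : TEV m) ∈ Sym2.map Subtype.val e := by
          rw [h]
          simp [top', src, tgt]
        rw [Sym2.mem_map] at h1
        obtain ⟨v, _, hv⟩ := h1
        exact v.2 hv
    · intro c hc x hx
      have h1 : src x ≠ Sum.inl 3 ∧ tgt x ≠ Sum.inl 3 := by
        rcases c with i | (_ | _)
        · rcases x with i | i | x
          · simp [src, tgt]
          · simp [src, tgt]
          · simp [up, dn] at hx
        · rcases x with i | i | x
          · simp [src, tgt]
          · simp [src, tgt]
          · revert x
            simp only [up, dn, Fin.forall_fin_succ]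
            simp [src, tgt]
        · simp only [idx] at hc
          omega
      exact ⟨s(⟨src x, h1.1⟩, ⟨tgt x, h1.2⟩), twoEar_adj m x, rfl⟩

end Paper
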